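/- For every positive integer n, the number of inversion sequences of size n avoiding both patterns 210 and 100 equals the number of plane permutations of size n (equivalently, the number of semi-Baxter permutations of size n). (Theorem 3.7.) -/

import Mathlib

/-- `f` contains the vincular pattern 2-41-3. -/
def Contains2413 {m : ℕ} (f : Fin m → Fin m) : Prop :=
  ∃ i j j' k : Fin m, (i : ℕ) < (j : ℕ) ∧ (j' : ℕ) = (j : ℕ) + 1 ∧ (j' : ℕ) < (k : ℕ) ∧
    f j' < f i ∧ f i < f k ∧ f k < f j

/-- `f` contains the vincular pattern 2-14-3. -/
def Contains2143 {m : ℕ} (f : Fin m → Fin m) : Prop :=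
  ∃ i j j' k : Fin m, (i : ℕ) < (j : ℕ) ∧ (j' : ℕ) = (j : ℕ) + 1 ∧ (j' : ℕ) < (k : ℕ) ∧
    f j < f i ∧ f i < f k ∧ f k < f j'

def IsSemiBaxter {n : ℕ} (π : Equiv.Perm (Fin n)) : Prop := ¬ Contains2413 ⇑π

def IsPlane {n : ℕ} (π : Equiv.Perm (Fin n)) : Prop := ¬ Contains2143 ⇑π

noncomputable def semiBaxterCount (n : ℕ) : ℕ :=
  Nat.card {π : Equiv.Perm (Fin n) // IsSemiBaxter π}

noncomputable def planeCount (n : ℕ) : ℕ :=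
  Nat.card {π : Equiv.Perm (Fin n) // IsPlane π}

/-- An inversion sequence of size `n` (0-indexed): `e i ≤ i` for all `i`,
i.e. `0 ≤ e_i < i` in the 1-indexed convention. -/
def IsInvSeq {n : ℕ} (e : Fin n → ℕ) : Prop := ∀ i : Fin n, e i ≤ (i : ℕ)

/-- `e` contains the pattern 210: indices `i < j < k` with `e i > e j > e k`. -/
def InvContains210 {n : ℕ} (e : Fin n → ℕ) : Prop :=
  ∃ i j k : Fin n, i < j ∧ j < k ∧ e j < e i ∧ e k < e j

/-- `e` contains the pattern 100: indices `i < j < k` with `e i > e j` and `e j = e k`. -/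
def InvContains100 {n : ℕ} (e : Fin n → ℕ) : Prop :=
  ∃ i j k : Fin n, i < j ∧ j < k ∧ e j < e i ∧ e j = e k

noncomputable def invSeqCount (n : ℕ) : ℕ :=
  Nat.card {e : Fin n → ℕ // IsInvSeq e ∧ ¬ InvContains210 e ∧ ¬ InvContains100 e}

open Finset

/-- One step of the semi-Baxter succession rule: a node labelled `(h, k)` has children labelled
`(1, k + 1), …, (h, k + 1)` and `(h + 1, k), …, (h + k, 1)`; the value at `(h, k)` is the sum of
`f` over the labels of the children. -/
def semiBaxterStep (f : ℕ → ℕ → ℕ) (h k : ℕ) : ℕ :=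
  ∑ i ∈ range h, f (i + 1) (k + 1) + ∑ j ∈ range k, f (h + j + 1) (k - j)

/-- A family of finite sets whose labels grow by the semi-Baxter rule is counted by iterating
that rule on the label of the root. -/
theorem card_eq_iterate_semiBaxterStep {X : ℕ → Type*} (A : ∀ n, Finset (X n))
    (h k : ∀ n, X n → ℕ) (h₀ k₀ : ℕ)
    (root : ∀ f : ℕ → ℕ → ℕ, ∑ x ∈ A 0, f (h 0 x) (k 0 x) = f h₀ k₀)
    (step : ∀ n (f : ℕ → ℕ → ℕ), ∑ x ∈ A (n + 1), f (h (n + 1) x) (k (n + 1) x) =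
      ∑ x ∈ A n, semiBaxterStep f (h n x) (k n x)) (n : ℕ) :
    #(A n) = semiBaxterStep^[n] (fun _ _ => 1) h₀ k₀ := by
  have key : ∀ n (f : ℕ → ℕ → ℕ),
      ∑ x ∈ A n, f (h n x) (k n x) = semiBaxterStep^[n] f h₀ k₀ := by
    intro n
    induction n with
    | zero => exact root
    | succ n ih =>
      intro f
      rw [step, ih (semiBaxterStep f), Function.iterate_succ_apply]
  simpa using key n fun _ _ => 1

/-- The two degenerate root labels `(0, 1)` and `(1, 0)` both have the single child `(1, 1)`. -/
theorem iterate_semiBaxterStep_zero_one (n : ℕ) :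
    semiBaxterStep^[n] (fun _ _ => 1) 0 1 = semiBaxterStep^[n] (fun _ _ => 1) 1 0 := by
  cases n with
  | zero => rfl
  | succ n => simp [Function.iterate_succ_apply', semiBaxterStep]

theorem sum_card_filter_le {α M : Type*} [LinearOrder α] [AddCommMonoid M] (A : Finset α)
    (g : ℕ → M) : ∑ a ∈ A, g #{s ∈ A | s ≤ a} = ∑ i ∈ range #A, g (i + 1) := by
  induction A using Finset.induction_on_max with
  | empty => simp
  | insert a A hA ih =>
    have ha : a ∉ A := fun h => lt_irrefl _ (hA a h)
    have hlast : ({s ∈ insert a A | s ≤ a} : Finset α) = insert a A :=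
      filter_true_of_mem fun s hs => by
        rcases mem_insert.1 hs with rfl | hs
        exacts [le_rfl, (hA s hs).le]
    rw [sum_insert ha, card_insert_of_notMem ha, sum_range_succ, ← ih, hlast,
      card_insert_of_notMem ha, add_comm]
    congr 1
    refine sum_congr rfl fun x hx => ?_
    rw [filter_insert, if_neg (hA x hx).not_ge]

theorem sum_card_filter_ge {α M : Type*} [LinearOrder α] [AddCommMonoid M] (A : Finset α)
    (g : ℕ → M) : ∑ a ∈ A, g #{s ∈ A | a ≤ s} = ∑ i ∈ range #A, g (i + 1) :=
  sum_card_filter_le (α := αᵒᵈ) A g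

/-! ### Inversion sequences avoiding 210 and 100 -/

/-- Inversion sequences avoiding 210 and 100. -/
def IsGoodInvSeq {n : ℕ} (e : Fin n → ℕ) : Prop :=
  IsInvSeq e ∧ ¬ InvContains210 e ∧ ¬ InvContains100 e

open Classical in
/-- The finite set of inversion sequences of size `n` avoiding 210 and 100. -/
noncomputable def goodInvSeqs (n : ℕ) : Finset (Fin n → ℕ) :=
  {e ∈ Fintype.piFinset fun i : Fin n => range (i + 1) | IsGoodInvSeq e}

theorem mem_goodInvSeqs {n : ℕ} {e : Fin n → ℕ} : e ∈ goodInvSeqs n ↔ IsGoodInvSeq e := by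
  simp only [goodInvSeqs, mem_filter, Fintype.mem_piFinset, mem_range, Nat.lt_succ_iff,
    and_iff_right_iff_imp]
  exact fun h => h.1

/-- One more than the maximum of `e`. -/
def topValue {n : ℕ} (e : Fin n → ℕ) : ℕ := univ.sup fun i => e i + 1

/-- One more than the largest entry of `e` having a larger entry to its left. -/
def bottomValue {n : ℕ} (e : Fin n → ℕ) : ℕ :=
  ({j | ∃ i < j, e j < e i} : Finset (Fin n)).sup fun j => e j + 1

theorem topValue_le_iff {n : ℕ} {e : Fin n → ℕ} {p : ℕ} :
    topValue e ≤ p ↔ ∀ i, e i < p := by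
  simp [topValue, Finset.sup_le_iff]

theorem bottomValue_le_iff {n : ℕ} {e : Fin n → ℕ} {p : ℕ} :
    bottomValue e ≤ p ↔ ∀ i j, i < j → e j < e i → e j < p := by
  simp only [bottomValue, Finset.sup_le_iff, mem_filter, mem_univ, true_and, Nat.succ_le_iff]
  exact ⟨fun H i j hij he => H j ⟨i, hij, he⟩, fun H j ⟨i, hij, he⟩ => H i j hij he⟩

theorem topValue_le {n : ℕ} {e : Fin n → ℕ} (he : IsInvSeq e) : topValue e ≤ n :=
  topValue_le_iff.2 fun i => (he i).trans_lt i.2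

theorem bottomValue_le_pred_topValue {n : ℕ} (e : Fin n → ℕ) :
    bottomValue e ≤ topValue e - 1 := by
  rw [bottomValue_le_iff]
  intro i j _ hlt
  have := topValue_le_iff.1 (le_refl (topValue e)) i
  omega

theorem topValue_eq_zero_iff {n : ℕ} {e : Fin n → ℕ} : topValue e = 0 ↔ n = 0 := by
  rw [← Nat.le_zero, topValue_le_iff]
  simp only [Nat.not_lt_zero]
  cases n with
  | zero => simp
  | succ n => simp

theorem topValue_snoc {n : ℕ} (e : Fin n → ℕ) (p : ℕ) :
    topValue (Fin.snoc e p : Fin (n + 1) → ℕ) = max (topValue e) (p + 1) := by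
  refine eq_of_forall_ge_iff fun c => ?_
  simp [topValue_le_iff, Fin.forall_fin_succ']

theorem bottomValue_snoc {n : ℕ} (e : Fin n → ℕ) (p : ℕ) (hp : bottomValue e ≤ p) :
    bottomValue (Fin.snoc e p : Fin (n + 1) → ℕ) =
      if p + 1 < topValue e then p + 1 else bottomValue e := by
  have htop : p + 1 < topValue e ↔ ∃ i, p < e i := by
    rw [← not_le, topValue_le_iff]; simp
  refine eq_of_forall_ge_iff fun c => ?_
  have hc : bottomValue (Fin.snoc e p : Fin (n + 1) → ℕ) ≤ c ↔
      bottomValue e ≤ c ∧ ((∃ i, p < e i) → p < c) := by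
    simp only [bottomValue_le_iff, Fin.forall_fin_succ', Fin.snoc_castSucc, Fin.snoc_last,
      Fin.castSucc_lt_castSucc_iff, Fin.castSucc_lt_last, lt_irrefl, not_lt_of_ge (Fin.le_last _)]
    grind
  rw [hc, ← htop]
  split_ifs <;> grind

theorem isGoodInvSeq_snoc {n : ℕ} (e : Fin n → ℕ) (p : ℕ) :
    IsGoodInvSeq (Fin.snoc e p : Fin (n + 1) → ℕ) ↔
      IsGoodInvSeq e ∧ p ∈ Ico (bottomValue e) (n + 1) := by
  have hrange : IsInvSeq (Fin.snoc e p : Fin (n + 1) → ℕ) ↔ IsInvSeq e ∧ p ≤ n := by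
    simp [IsInvSeq, Fin.forall_fin_succ']
  rw [IsGoodInvSeq, hrange, mem_Ico, bottomValue_le_iff]
  simp only [IsGoodInvSeq, InvContains210, InvContains100, Fin.exists_fin_succ', Fin.snoc_castSucc,
      Fin.snoc_last, Fin.castSucc_lt_castSucc_iff, Fin.castSucc_lt_last, lt_irrefl,
      not_lt_of_ge (Fin.le_last _)]
  grind

theorem sum_goodInvSeqs_succ {M : Type*} [AddCommMonoid M] (n : ℕ) (g : (Fin (n + 1) → ℕ) → M) :
    ∑ e ∈ goodInvSeqs (n + 1), g e =
      ∑ e ∈ goodInvSeqs n, ∑ p ∈ Ico (bottomValue e) (n + 1), g (Fin.snoc e p) := by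
  rw [sum_sigma']
  refine sum_nbij' (fun e => ⟨Fin.init e, e (Fin.last n)⟩) (fun x => Fin.snoc x.1 x.2)
    ?_ ?_ ?_ ?_ ?_
  · intro e he
    rw [← Fin.snoc_init_self e, mem_goodInvSeqs, isGoodInvSeq_snoc] at he
    simpa [mem_goodInvSeqs] using he
  · intro x hx
    rw [mem_goodInvSeqs, isGoodInvSeq_snoc]
    simpa [mem_goodInvSeqs] using hx
  · simp
  · simp
  · simp

theorem sum_goodInvSeq_children {n : ℕ} {e : Fin n → ℕ} (he : IsGoodInvSeq e)
    (f : ℕ → ℕ → ℕ) :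
    ∑ p ∈ Ico (bottomValue e) (n + 1),
        f (topValue (Fin.snoc e p : Fin (n + 1) → ℕ) - bottomValue (Fin.snoc e p : Fin (n + 1) → ℕ))
          (n + 1 + 1 - topValue (Fin.snoc e p : Fin (n + 1) → ℕ)) =
      semiBaxterStep f (topValue e - bottomValue e) (n + 1 - topValue e) := by
  have hle := topValue_le he.1
  have hbot := bottomValue_le_pred_topValue e
  have hzero := topValue_eq_zero_iff (e := e)
  have hsnoc : ∀ p ∈ Ico (bottomValue e) (n + 1),
      f (topValue (Fin.snoc e p : Fin (n + 1) → ℕ) - bottomValue (Fin.snoc e p : Fin (n + 1) → ℕ))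
          (n + 1 + 1 - topValue (Fin.snoc e p : Fin (n + 1) → ℕ)) =
        if p + 1 < topValue e then f (topValue e - (p + 1)) (n + 1 + 1 - topValue e)
        else f (p + 1 - bottomValue e) (n + 1 - p) := by
    intro p hp
    rw [topValue_snoc, bottomValue_snoc e p (mem_Ico.1 hp).1]
    split_ifs with hlt
    · rw [max_eq_left hlt.le]
    · rw [max_eq_right (not_lt.1 hlt)]; congr 1; omega
  rw [sum_congr rfl hsnoc]
  generalize topValue e = t at *
  generalize bottomValue e = b at *
  rw [← sum_Ico_consecutive _ (show b ≤ t by omega) (show t ≤ n + 1 by omega), semiBaxterStep]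
  congr 1
  · rcases Nat.eq_zero_or_pos t with rfl | ht
    · simp
    obtain ⟨d, rfl⟩ : ∃ d, t = b + d + 1 := ⟨t - 1 - b, by omega⟩
    rw [sum_Ico_eq_sum_range, show b + d + 1 - b = d + 1 by omega, sum_range_succ,
      sum_range_succ, ← sum_range_reflect (fun i => f (i + 1) _)]
    congr 1
    · refine sum_congr rfl fun i hi => ?_
      have := mem_range.1 hi
      rw [if_pos (by omega)]
      congr 1 <;> omega
    · rw [if_neg (by omega)]
      congr 1 <;> omega
  · rw [sum_Ico_eq_sum_range]
    refine sum_congr rfl fun i hi => ?_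
    rw [if_neg (by omega)]
    congr 1 <;> omega

theorem invSeqCount_eq_iterate (n : ℕ) :
    invSeqCount n = semiBaxterStep^[n] (fun _ _ => 1) 0 1 := by
  have hcard : invSeqCount n = #(goodInvSeqs n) :=
    Nat.subtype_card _ fun e => mem_goodInvSeqs
  rw [hcard]
  refine card_eq_iterate_semiBaxterStep goodInvSeqs
    (fun _ e => topValue e - bottomValue e) (fun n e => n + 1 - topValue e) 0 1 ?_ ?_ n
  · intro f
    have huniv : goodInvSeqs 0 = univ := eq_univ_of_forall fun e => by
      simp [mem_goodInvSeqs, IsGoodInvSeq, IsInvSeq, InvContains210, InvContains100]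
    simp [huniv, topValue]
  · intro n f
    rw [sum_goodInvSeqs_succ]
    exact sum_congr rfl fun e he => sum_goodInvSeq_children (mem_goodInvSeqs.1 he) f

/-! ### Permutations avoiding 2-41-3 or 2-14-3 -/

/-- `f` contains the vincular pattern 2-14-3 (if `up` is true) or 2-41-3 (if `up` is false). -/
def ContainsVincular (up : Bool) {m : ℕ} (f : Fin m → Fin m) : Prop :=
  ∃ i j j' k : Fin m, (i : ℕ) < (j : ℕ) ∧ (j' : ℕ) = (j : ℕ) + 1 ∧ (j' : ℕ) < (k : ℕ) ∧
    cond up (f j) (f j') < f i ∧ f i < f k ∧ f k < cond up (f j') (f j)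

/-- Appending the value `s` to `f` (and raising the values at least `s`) creates an occurrence of
the vincular pattern whose last letter is the new one. -/
def IsInactiveSite (up : Bool) {m : ℕ} (f : Fin m → Fin m) (s : ℕ) : Prop :=
  ∃ i j j' : Fin m, (i : ℕ) < (j : ℕ) ∧ (j' : ℕ) = (j : ℕ) + 1 ∧
    (cond up (f j) (f j') : ℕ) < f i ∧ (f i : ℕ) < s ∧ s ≤ cond up (f j') (f j)

/-- The permutation obtained from `σ` by appending the value `a` on the right, raising by one the
values that are at least `a`. -/
def appendValue {n : ℕ} (σ : Equiv.Perm (Fin n)) (a : Fin (n + 1)) : Equiv.Perm (Fin (n + 1)) :=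
  (finSuccEquivLast.trans (Equiv.optionCongr σ)).trans (finSuccEquiv' a).symm

@[simp]
theorem appendValue_last {n : ℕ} (σ : Equiv.Perm (Fin n)) (a : Fin (n + 1)) :
    appendValue σ a (Fin.last n) = a := by
  simp [appendValue]

@[simp]
theorem appendValue_castSucc {n : ℕ} (σ : Equiv.Perm (Fin n)) (a : Fin (n + 1)) (i : Fin n) :
    appendValue σ a i.castSucc = a.succAbove (σ i) := by
  simp [appendValue]

theorem appendValue_bijective (n : ℕ) :
    Function.Bijective fun x : Equiv.Perm (Fin n) × Fin (n + 1) => appendValue x.1 x.2 := by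
  rw [Fintype.bijective_iff_injective_and_card]
  constructor
  · rintro ⟨σ, a⟩ ⟨τ, b⟩ h
    obtain rfl : a = b := by simpa using DFunLike.congr_fun h (Fin.last n)
    have : σ = τ := Equiv.ext fun i => by
      simpa using DFunLike.congr_fun h i.castSucc
    rw [this]
  · simp [Fintype.card_perm, Nat.factorial_succ, mul_comm]

theorem val_succAbove {n : ℕ} (a : Fin (n + 1)) (x : Fin n) :
    (a.succAbove x : ℕ) = if (x : ℕ) < a then (x : ℕ) else x + 1 := by
  simp only [Fin.succAbove, Fin.lt_def, Fin.val_castSucc]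
  split_ifs <;> simp

theorem containsVincular_appendValue (up : Bool) {n : ℕ} (σ : Equiv.Perm (Fin n))
    (a : Fin (n + 1)) :
    ContainsVincular up (appendValue σ a) ↔
      ContainsVincular up σ ∨ IsInactiveSite up σ a := by
  constructor
  · rintro ⟨i, j, j', k, hij, hj, hk, h₁, h₂, h₃⟩
    obtain ⟨i, rfl⟩ := Fin.exists_castSucc_eq.2 (show i ≠ Fin.last n by grind)
    obtain ⟨j, rfl⟩ := Fin.exists_castSucc_eq.2 (show j ≠ Fin.last n by grind)
    obtain ⟨j', rfl⟩ := Fin.exists_castSucc_eq.2 (show j' ≠ Fin.last n by grind)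
    induction k using Fin.lastCases with
    | last =>
      right
      refine ⟨i, j, j', hij, hj, ?_⟩
      rw [Fin.lt_def] at h₁ h₂ h₃
      cases up <;> simp [val_succAbove] at h₁ h₂ h₃ ⊢ <;> grind
    | cast k =>
      left
      refine ⟨i, j, j', k, hij, hj, hk, ?_⟩
      cases up <;> simp at h₁ h₂ h₃ ⊢ <;> exact ⟨h₁, h₂, h₃⟩
  · rintro (⟨i, j, j', k, hij, hj, hk, h⟩ | ⟨i, j, j', hij, hj, h⟩)
    · refine ⟨i.castSucc, j.castSucc, j'.castSucc, k.castSucc, hij, hj, hk, ?_⟩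
      cases up <;> simpa using h
    · refine ⟨i.castSucc, j.castSucc, j'.castSucc, Fin.last n, hij, hj, by simp, ?_⟩
      simp only [Fin.lt_def]
      cases up <;> simp [val_succAbove] at h ⊢ <;> grind

/-- One more than the last value of `σ`, or `0` if `σ` is empty. -/
def lastRank : ∀ {n : ℕ}, Equiv.Perm (Fin n) → ℕ
  | 0, _ => 0
  | n + 1, σ => σ (Fin.last n) + 1

theorem lastRank_appendValue {n : ℕ} (σ : Equiv.Perm (Fin n)) (a : Fin (n + 1)) :
    lastRank (appendValue σ a) = a + 1 := by
  simp [lastRank]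

theorem isInactiveSite_appendValue (up : Bool) {n : ℕ} (σ : Equiv.Perm (Fin n))
    (a : Fin (n + 1)) (s : ℕ) :
    IsInactiveSite up (appendValue σ a) s ↔
      IsInactiveSite up σ (if s ≤ a then s else s - 1) ∨
        cond up (lastRank σ < s ∧ s ≤ a) ((a : ℕ) + 1 < s ∧ s ≤ lastRank σ) := by
  constructor
  · rintro ⟨i, j, j', hij, hj, h⟩
    obtain ⟨i, rfl⟩ := Fin.exists_castSucc_eq.2 (show i ≠ Fin.last n by grind)
    obtain ⟨j, rfl⟩ := Fin.exists_castSucc_eq.2 (show j ≠ Fin.last n by grind)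
    induction j' using Fin.lastCases with
    | last =>
      right
      cases n with
      | zero => exact i.elim0
      | succ n =>
      obtain rfl : j = Fin.last n := by ext; simp at hj ⊢; omega
      cases up <;> simp [lastRank, val_succAbove] at h ⊢ <;> grind
    | cast j' =>
      left
      refine ⟨i, j, j', hij, hj, ?_⟩
      cases up <;> simp [val_succAbove] at h ⊢ <;> grind
  · rintro (⟨i, j, j', hij, hj, h⟩ | h)
    · refine ⟨i.castSucc, j.castSucc, j'.castSucc, hij, hj, ?_⟩
      cases up <;> simp [val_succAbove] at h ⊢ <;> grind
    · cases n with
      | zero => cases up <;> simp [lastRank] at h <;> omega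
      | succ n =>
      have witness : ∀ v : ℕ, v < n + 1 → v ≠ σ (Fin.last n) →
          ∃ i : Fin (n + 1), (i : ℕ) < n ∧ (σ i : ℕ) = v := by
        intro v hv hne
        refine ⟨σ.symm ⟨v, hv⟩, ?_, by simp⟩
        have : σ.symm ⟨v, hv⟩ ≠ Fin.last n := by
          rintro heq
          exact hne (by rw [← heq]; simp)
        exact Fin.val_lt_last this
      cases up
      · simp only [cond_false, lastRank] at h
        obtain ⟨i, hi, hv⟩ := witness a (by omega) (by omega)
        refine ⟨i.castSucc, (Fin.last n).castSucc, Fin.last (n + 1), by simpa using hi, by simp, ?_⟩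
        simp [val_succAbove]
        grind
      · simp only [cond_true, lastRank] at h
        obtain ⟨i, hi, hv⟩ := witness (σ (Fin.last n) + 1) (by omega) (by omega)
        refine ⟨i.castSucc, (Fin.last n).castSucc, Fin.last (n + 1), by simpa using hi, by simp, ?_⟩
        simp [val_succAbove]
        grind

open Classical in
/-- The values that can be appended to `σ` without creating the vincular pattern. -/
noncomputable def activeSites (up : Bool) {n : ℕ} (σ : Equiv.Perm (Fin n)) : Finset ℕ :=
  {s ∈ range (n + 1) | ¬ IsInactiveSite up σ s}

/-- The number of active sites below the last value of `σ`. -/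
noncomputable def lowerSites (up : Bool) {n : ℕ} (σ : Equiv.Perm (Fin n)) : ℕ :=
  #{s ∈ activeSites up σ | s < lastRank σ}

/-- The number of active sites above the last value of `σ`. -/
noncomputable def upperSites (up : Bool) {n : ℕ} (σ : Equiv.Perm (Fin n)) : ℕ :=
  #{s ∈ activeSites up σ | lastRank σ ≤ s}

open Classical in
/-- The permutations of size `n` avoiding the vincular pattern. -/
noncomputable def vincularAvoiders (up : Bool) (n : ℕ) : Finset (Equiv.Perm (Fin n)) :=
  {σ | ¬ ContainsVincular up σ}

theorem mem_vincularAvoiders {up : Bool} {n : ℕ} {σ : Equiv.Perm (Fin n)} :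
    σ ∈ vincularAvoiders up n ↔ ¬ ContainsVincular up σ := by
  simp [vincularAvoiders]

theorem lastRank_le {n : ℕ} (σ : Equiv.Perm (Fin n)) : lastRank σ ≤ n := by
  cases n with
  | zero => simp [lastRank]
  | succ n => simp only [lastRank]; omega

theorem lastRank_mem_activeSites {n : ℕ} {σ : Equiv.Perm (Fin n)}
    (hσ : ¬ ContainsVincular true σ) : lastRank σ ∈ activeSites true σ := by
  simp only [activeSites, mem_filter, mem_range]
  refine ⟨Nat.lt_succ_of_le (lastRank_le σ), ?_⟩
  rintro ⟨i, j, j', hij, hj, h₁, h₂, h₃⟩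
  cases n with
  | zero => exact i.elim0
  | succ n =>
  simp only [cond_true, lastRank] at h₁ h₂ h₃
  refine hσ ⟨i, j, j', Fin.last n, hij, hj, ?_, by simpa using h₁, ?_, ?_⟩
  · have : j' ≠ Fin.last n := by rintro rfl; omega
    exact Fin.val_lt_last this
  · have : σ i ≠ σ (Fin.last n) := by
      intro h
      have := σ.injective h
      grind
    grind
  · simp only [cond_true, Fin.lt_def]; omega

theorem mem_activeSites_appendValue {up : Bool} {n : ℕ} {σ : Equiv.Perm (Fin n)}
    {a : Fin (n + 1)} {s : ℕ} :
    s ∈ activeSites up (appendValue σ a) ↔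
      (if s ≤ a then s else s - 1) ∈ activeSites up σ ∧
        ¬ cond up (lastRank σ < s ∧ s ≤ a) ((a : ℕ) + 1 < s ∧ s ≤ lastRank σ) := by
  simp only [activeSites, mem_filter, mem_range, isInactiveSite_appendValue, not_or]
  have := a.2
  split_ifs <;> grind

theorem lowerSites_appendValue (up : Bool) {n : ℕ} (σ : Equiv.Perm (Fin n)) (a : Fin (n + 1)) :
    lowerSites up (appendValue σ a) =
      #{s ∈ activeSites up σ | s ≤ (a : ℕ) ∧ ¬ (up = true ∧ lastRank σ < s)} := by
  rw [lowerSites, lastRank_appendValue]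
  congr 1
  ext s
  simp only [mem_filter, mem_activeSites_appendValue]
  cases up <;> grind

theorem upperSites_appendValue (up : Bool) {n : ℕ} (σ : Equiv.Perm (Fin n)) (a : Fin (n + 1)) :
    upperSites up (appendValue σ a) =
      #{s ∈ activeSites up σ | (a : ℕ) ≤ s ∧ ¬ (up = false ∧ (a : ℕ) < s ∧ s < lastRank σ)} := by
  rw [upperSites, lastRank_appendValue]
  refine card_nbij' (fun s => s - 1) (fun s => s + 1) ?_ ?_ ?_ ?_
  · intro s
    simp only [mem_coe, mem_filter, mem_activeSites_appendValue]
    cases up <;> grind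
  · intro s
    simp only [mem_coe, mem_filter, mem_activeSites_appendValue]
    cases up <;> grind
  · intro s hs
    simp only [mem_coe, mem_filter] at hs
    grind
  · intro s _
    simp

theorem sum_vincularAvoiders_succ (up : Bool) (n : ℕ) (g : Equiv.Perm (Fin (n + 1)) → ℕ)
    (G : Equiv.Perm (Fin n) → ℕ → ℕ)
    (hG : ∀ σ ∈ vincularAvoiders up n, ∀ a : Fin (n + 1), ↑a ∈ activeSites up σ →
      g (appendValue σ a) = G σ a) :
    ∑ π ∈ vincularAvoiders up (n + 1), g π =
      ∑ σ ∈ vincularAvoiders up n, ∑ a ∈ activeSites up σ, G σ a := by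
  classical
  rw [vincularAvoiders, sum_filter, ← (appendValue_bijective n).sum_comp, Fintype.sum_prod_type,
    vincularAvoiders, sum_filter]
  refine sum_congr rfl fun σ _ => ?_
  by_cases hσ : ContainsVincular up σ
  · simp [containsVincular_appendValue, hσ]
  · rw [if_pos hσ, activeSites, sum_filter, ← Fin.sum_univ_eq_sum_range
      (fun a => if ¬ IsInactiveSite up σ a then G σ a else 0)]
    refine sum_congr rfl fun a _ => ?_
    simp only [containsVincular_appendValue, hσ, false_or]
    split_ifs with ha
    · rfl
    · refine hG σ (mem_vincularAvoiders.2 hσ) a ?_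
      simp only [activeSites, mem_filter, mem_range]
      exact ⟨a.2, ha⟩

theorem card_filter_le_add_card_filter_ge {α : Type*} [LinearOrder α] {T : Finset α} {a : α}
    (ha : a ∈ T) : #{s ∈ T | s ≤ a} + #{s ∈ T | a ≤ s} = #T + 1 := by
  rw [← card_union_add_card_inter, show {s ∈ T | s ≤ a} ∪ {s ∈ T | a ≤ s} = T by grind,
    show {s ∈ T | s ≤ a} ∩ {s ∈ T | a ≤ s} = {a} by grind, card_singleton]

theorem sum_semiBaxter_children (S : Finset ℕ) (L : ℕ) (f : ℕ → ℕ → ℕ) :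
    ∑ a ∈ S, f #{s ∈ S | s ≤ a} #{s ∈ S | a ≤ s ∧ ¬ (a < s ∧ s < L)} =
      semiBaxterStep f #{s ∈ S | s < L} #{s ∈ S | L ≤ s} := by
  rw [← sum_filter_add_sum_filter_not S (· < L), semiBaxterStep]
  simp only [not_lt]
  congr 1
  · rw [← sum_card_filter_le _ fun i => f i _]
    refine sum_congr rfl fun a ha => ?_
    rw [← card_insert_of_notMem (a := a) (s := {s ∈ S | L ≤ s}) (by grind)]
    congr 2 <;> grind
  · have hsum := sum_card_filter_le {s ∈ S | L ≤ s} fun i =>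
      f (#{s ∈ S | s < L} + i) (#{s ∈ S | L ≤ s} + 1 - i)
    simp only [← add_assoc, Nat.add_sub_add_right] at hsum
    rw [← hsum]
    refine sum_congr rfl fun a ha => ?_
    rw [← card_filter_le_add_card_filter_ge ha, Nat.add_sub_cancel_left,
      ← card_union_of_disjoint (disjoint_left.2 (by grind))]
    congr 2 <;> grind

theorem sum_plane_children (S : Finset ℕ) (L : ℕ) (hL : L ∈ S) (f : ℕ → ℕ → ℕ) :
    ∑ a ∈ S, f #{s ∈ S | a ≤ s} #{s ∈ S | s ≤ a ∧ ¬ L < s} =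
      semiBaxterStep f #{s ∈ S | L ≤ s} #{s ∈ S | s < L} := by
  rw [← sum_filter_not_add_sum_filter S (· < L), semiBaxterStep]
  simp only [not_lt]
  congr 1
  · rw [← sum_card_filter_ge _ fun i => f i _]
    refine sum_congr rfl fun a ha => ?_
    rw [← card_insert_of_notMem (a := L) (s := {s ∈ S | s < L}) (by grind)]
    congr 2 <;> grind
  · have hsum := sum_card_filter_ge {s ∈ S | s < L} fun i =>
      f (#{s ∈ S | L ≤ s} + i) (#{s ∈ S | s < L} + 1 - i)
    simp only [← add_assoc, Nat.add_sub_add_right] at hsum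
    rw [← hsum]
    refine sum_congr rfl fun a ha => ?_
    rw [← card_filter_le_add_card_filter_ge ha, Nat.add_sub_cancel_right,
      ← card_union_of_disjoint (disjoint_left.2 (by grind))]
    congr 2 <;> grind

theorem sum_vincularAvoiders_zero (up : Bool) (f : ℕ → ℕ → ℕ) :
    ∑ σ ∈ vincularAvoiders up 0, f (lowerSites up σ) (upperSites up σ) = f 0 1 := by
  simp [vincularAvoiders, ContainsVincular, lowerSites, upperSites, lastRank, activeSites,
    IsInactiveSite]

theorem semiBaxterCount_eq_iterate (n : ℕ) :
    semiBaxterCount n = semiBaxterStep^[n] (fun _ _ => 1) 0 1 := by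
  have hcard : semiBaxterCount n = #(vincularAvoiders false n) :=
    Nat.subtype_card _ fun _ => mem_vincularAvoiders
  rw [hcard]
  refine card_eq_iterate_semiBaxterStep (vincularAvoiders false)
    (fun _ σ => lowerSites false σ) (fun _ σ => upperSites false σ) 0 1
    (sum_vincularAvoiders_zero false) (fun n f => ?_) n
  rw [sum_vincularAvoiders_succ false n _ fun σ a => f #{s ∈ activeSites false σ | s ≤ a}
      #{s ∈ activeSites false σ | a ≤ s ∧ ¬ (a < s ∧ s < lastRank σ)}]
  · exact sum_congr rfl fun σ _ => sum_semiBaxter_children _ _ f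
  · intro σ _ a _
    simp [lowerSites_appendValue, upperSites_appendValue]

theorem planeCount_eq_iterate (n : ℕ) :
    planeCount n = semiBaxterStep^[n] (fun _ _ => 1) 1 0 := by
  have hcard : planeCount n = #(vincularAvoiders true n) :=
    Nat.subtype_card _ fun _ => mem_vincularAvoiders
  rw [hcard]
  refine card_eq_iterate_semiBaxterStep (vincularAvoiders true)
    (fun _ σ => upperSites true σ) (fun _ σ => lowerSites true σ) 1 0
    (fun f => sum_vincularAvoiders_zero true fun h k => f k h) (fun n f => ?_) n
  rw [sum_vincularAvoiders_succ true n _ fun σ a => f #{s ∈ activeSites true σ | a ≤ s}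
      #{s ∈ activeSites true σ | s ≤ a ∧ ¬ lastRank σ < s}]
  · refine sum_congr rfl fun σ hσ => sum_plane_children _ _ ?_ f
    exact lastRank_mem_activeSites (mem_vincularAvoiders.1 hσ)
  · intro σ _ a _
    simp [lowerSites_appendValue, upperSites_appendValue]

/-- Theorem 3.7: inversion sequences of size `n` avoiding 210 and 100 are equinumerous
with plane permutations (equivalently, semi-Baxter permutations) of size `n`. -/
theorem invSeq_eq_plane_count (n : ℕ) (hn : 0 < n) :
    invSeqCount n = planeCount n ∧ invSeqCount n = semiBaxterCount n := by
  rw [invSeqCount_eq_iterate, planeCount_eq_iterate, semiBaxterCount_eq_iterate]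
  exact ⟨iterate_semiBaxterStep_zero_one n, rfl⟩
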